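/- Under assumptions (A.1)–(A.4), let G* be a Laplace–Laplace Gaussian HMoE mixing measure with k₁* groups and k₂* experts per group, let (X₁,Y₁),…,(Xₙ,Yₙ) be i.i.d. with each Xᵢ distributed according to a probability measure μ on ℝ^d with bounded support and Yᵢ given Xᵢ = x distributed with density p^LL_{G*}(·|x), and for k₂ > k₂* let Ĝₙ be any maximizer over G ∈ 𝒢_{k₁*,k₂}(Θ) of the empirical log-likelihood (1/n)·Σ_{i=1}^n log p^LL_G(Yᵢ|Xᵢ). Then there exist universal constants C₁, c₁, C₂ > 0 such that for every n ≥ 2, the probability that E_{X∼μ}[ h(p^LL_{Ĝₙ}(·|X), p^LL_{G*}(·|X)) ] > C₁·√(log n / n) is at most C₂·exp(−c₁·log n). -/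

import Mathlib

open scoped RealInnerProductSpace

noncomputable section

/-- Euclidean input space `ℝ^d`. -/
abbrev Euc (d : ℕ) := EuclideanSpace ℝ (Fin d)

/-- Univariate Gaussian density `π(y|μ,ν) = (2πν)^(-1/2) exp(-(y-μ)²/(2ν))`. -/
def gaussPDF (m v y : ℝ) : ℝ :=
  (Real.sqrt (2 * Real.pi * v))⁻¹ * Real.exp (-(y - m) ^ 2 / (2 * v))

/-- Parameters of a two-level Gaussian HMoE with `k1` groups and `k2` experts per group:
first-level gating parameters `(b_{i₁}, a_{i₁})`, second-level gating parameters
`(β_{i₂|i₁}, ω_{i₂|i₁})`, and expert parameters `(η_{i₁i₂}, τ_{i₁i₂}, ν_{i₁i₂})`. -/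
structure HMoE (d k1 k2 : ℕ) where
  b : Fin k1 → ℝ
  a : Fin k1 → Euc d
  β : Fin k1 → Fin k2 → ℝ
  ω : Fin k1 → Fin k2 → Euc d
  η : Fin k1 → Fin k2 → Euc d
  τ : Fin k1 → Fin k2 → ℝ
  ν : Fin k1 → Fin k2 → ℝ

/-- Conditional density of the Laplace–Laplace Gaussian HMoE. -/
def pLL {d k1 k2 : ℕ} (P : HMoE d k1 k2) (x : Euc d) (y : ℝ) : ℝ :=
  ∑ i1, (Real.exp (-‖P.a i1 - x‖ + P.b i1) /
      ∑ j1, Real.exp (-‖P.a j1 - x‖ + P.b j1)) *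
    ∑ i2, (Real.exp (-‖P.ω i1 i2 - x‖ + P.β i1 i2) /
        ∑ j2, Real.exp (-‖P.ω i1 j2 - x‖ + P.β i1 j2)) *
      gaussPDF (⟪P.η i1 i2, x⟫ + P.τ i1 i2) (P.ν i1 i2) y

open MeasureTheory

/-- All parameter tuples `(b, a, β, ω, η, τ, ν)` of `P` lie in the parameter space `Θ`. -/
def inParamSpace {d k1 k2 : ℕ}
    (Θ : Set (ℝ × Euc d × ℝ × Euc d × Euc d × ℝ × ℝ)) (P : HMoE d k1 k2) : Prop :=
  ∀ i1 i2, (P.b i1, P.a i1, P.β i1 i2, P.ω i1 i2, P.η i1 i2, P.τ i1 i2, P.ν i1 i2) ∈ Θ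

/-- A candidate mixing measure with `k1` groups and an arbitrary number of experts per
group (encoded by the first component). -/
def Candidate (d k1 : ℕ) := Σ k2' : ℕ, HMoE d k1 k2'

/-- The class `𝒢_{k1,k2}(Θ)` of candidate mixing measures: at most `k2` (and at least one)
experts per group, with all parameters in `Θ`. -/
def candClass (d k1 k2 : ℕ) (Θ : Set (ℝ × Euc d × ℝ × Euc d × Euc d × ℝ × ℝ)) :
    Set (Candidate d k1) :=
  {c | 1 ≤ c.1 ∧ c.1 ≤ k2 ∧ inParamSpace Θ c.2}

/-- Hellinger distance between two conditional densities on `ℝ`: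
`h(p, q) = ( (1/2) ∫ (√p − √q)² )^{1/2}`. -/
def hellingerDist (p q : ℝ → ℝ) : ℝ :=
  Real.sqrt ((1 / 2) * ∫ y : ℝ, (Real.sqrt (p y) - Real.sqrt (q y)) ^ 2)

/-- Joint distribution of a pair `(X, Y)` where `X ∼ μ` and `Y | X = x` has Lebesgue
density `p x ·`. -/
def jointMeasure {d : ℕ} (μ : Measure (Euc d)) (p : Euc d → ℝ → ℝ) :
    Measure (Euc d × ℝ) :=
  (μ.prod volume).withDensity fun z => ENNReal.ofReal (p z.1 z.2)


/-! ## Covering lemma in finite-dimensional spaces -/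

lemma exists_cover {E : Type*} [NormedAddCommGroup E] [NormedSpace ℝ E] [FiniteDimensional ℝ E]
    (S : Set E) (hS : Bornology.IsBounded S) :
    ∃ (K : ℝ) (D : ℕ), 0 < K ∧ ∀ A : Set E, A ⊆ S → ∀ n : ℕ, 1 ≤ n →
      ∃ T : Finset E, (∀ t ∈ T, t ∈ A) ∧ (T.card : ℝ) ≤ K * (n : ℝ) ^ D ∧
        ∀ a ∈ A, ∃ t ∈ T, ‖a - t‖ ≤ 1 / (n : ℝ) ^ 2 := by
  classical
  set D := Module.finrank ℝ E with hD
  let e : E ≃L[ℝ] (Fin D → ℝ) := ContinuousLinearEquiv.ofFinrankEq (by simp [hD])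
  obtain ⟨c, hc, hce⟩ : ∃ c : ℝ, 1 ≤ c ∧ ∀ z, ‖e.symm z‖ ≤ c * ‖z‖ := by
    refine ⟨max 1 ‖(e.symm : (Fin D → ℝ) →L[ℝ] E)‖, le_max_left _ _, fun z => ?_⟩
    refine ((e.symm : (Fin D → ℝ) →L[ℝ] E).le_opNorm z).trans ?_
    gcongr
    exact le_max_right _ _
  obtain ⟨R, hR, hRe⟩ : ∃ R : ℝ, 0 ≤ R ∧ ∀ a ∈ S, ‖e a‖ ≤ R := by
    obtain ⟨R0, hR0⟩ := hS.exists_norm_le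
    refine ⟨‖(e : E →L[ℝ] (Fin D → ℝ))‖ * max R0 0, by positivity, fun a ha => ?_⟩
    refine ((e : E →L[ℝ] (Fin D → ℝ)).le_opNorm a).trans ?_
    gcongr
    exact (hR0 a ha).trans (le_max_left _ _)
  refine ⟨(2 * R * c + 5) ^ D, 2 * D, by positivity, fun A hA n hn => ?_⟩
  have hn' : (1 : ℝ) ≤ n := by exact_mod_cast hn
  set M : ℝ := c * (n : ℝ) ^ 2 with hM
  have hn2 : (1 : ℝ) ≤ (n : ℝ) ^ 2 := one_le_pow₀ hn'
  have hMpos : 0 < M := by positivity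
  let f : E → (Fin D → ℤ) := fun a i => ⌊e a i * M⌋
  let F : Finset (Fin D → ℤ) := Fintype.piFinset fun _ => Finset.Icc (-⌈R * M⌉ - 1) ⌈R * M⌉
  have hfF : ∀ a ∈ A, f a ∈ F := by
    intro a ha
    rw [Fintype.mem_piFinset]
    intro i
    have h1 : |e a i| ≤ R := by
      have := norm_le_pi_norm (e a) i
      rw [Real.norm_eq_abs] at this
      exact this.trans (hRe a (hA ha))
    have h2 := abs_le.1 h1
    have h3 : e a i * M ≤ R * M := by gcongr; exact h2.2
    have h4 : -(R * M) ≤ e a i * M := by nlinarith [h2.1]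
    have h5 := Int.le_ceil (R * M)
    rw [Finset.mem_Icc]
    constructor
    · rw [Int.le_floor]; push_cast; linarith
    · have : (⌊e a i * M⌋ : ℝ) ≤ ⌈R * M⌉ := (Int.floor_le _).trans (h3.trans h5)
      exact_mod_cast this
  let F' := F.filter fun z => ∃ a ∈ A, f a = z
  have hF' : ∀ z : F', ∃ a ∈ A, f a = z := fun z => (Finset.mem_filter.1 z.2).2
  choose g hgA hgf using hF'
  refine ⟨Finset.univ.image g, ?_, ?_, ?_⟩
  · intro t ht
    obtain ⟨z, -, rfl⟩ := Finset.mem_image.1 ht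
    exact hgA z
  · have h1 : (Finset.univ.image g).card ≤ F.card := by
      refine Finset.card_image_le.trans ?_
      simp only [Finset.card_univ, Fintype.card_coe]
      exact Finset.card_filter_le _ _
    have h2 : (F.card : ℝ) ≤ ((2 * R * c + 5) * (n : ℝ) ^ 2) ^ D := by
      simp only [F, Fintype.card_piFinset, Finset.prod_const, Finset.card_univ, Fintype.card_fin,
        Int.card_Icc]
      push_cast
      gcongr
      have h0 : 0 ≤ ⌈R * M⌉ := Int.ceil_nonneg (by positivity)
      have : ((⌈R * M⌉ + 1 - (-⌈R * M⌉ - 1)).toNat : ℝ) = 2 * ⌈R * M⌉ + 2 := by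
        have h := Int.toNat_of_nonneg (a := ⌈R * M⌉ + 1 - (-⌈R * M⌉ - 1)) (by omega)
        have h' : (((⌈R * M⌉ + 1 - (-⌈R * M⌉ - 1)).toNat : ℤ) : ℝ)
          = ((⌈R * M⌉ + 1 - (-⌈R * M⌉ - 1) : ℤ) : ℝ) := by rw [h]
        push_cast at h'
        rw [h']; ring
      rw [this]
      have := Int.ceil_lt_add_one (R * M)
      rw [hM] at this ⊢
      nlinarith
    calc ((Finset.univ.image g).card : ℝ) ≤ F.card := by exact_mod_cast h1
      _ ≤ _ := h2
      _ = _ := by rw [mul_pow, ← pow_mul]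
  · intro a ha
    have hz : f a ∈ F' := Finset.mem_filter.2 ⟨hfF a ha, a, ha, rfl⟩
    refine ⟨g ⟨f a, hz⟩, Finset.mem_image_of_mem _ (Finset.mem_univ _), ?_⟩
    set b := g ⟨f a, hz⟩ with hb
    have hfab : f b = f a := hgf ⟨f a, hz⟩
    have h1 : ‖e (a - b)‖ ≤ 1 / M := by
      rw [pi_norm_le_iff_of_nonneg (by positivity)]
      intro i
      have h2 : ⌊e a i * M⌋ = ⌊e b i * M⌋ := (congrFun hfab i).symm
      have h3 := Int.abs_sub_lt_one_of_floor_eq_floor h2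
      rw [Real.norm_eq_abs, le_div_iff₀ hMpos, map_sub, Pi.sub_apply]
      rw [← sub_mul, abs_mul, abs_of_pos hMpos] at h3
      exact h3.le
    calc ‖a - b‖ = ‖e.symm (e (a - b))‖ := by simp
      _ ≤ c * ‖e (a - b)‖ := hce _
      _ ≤ c * (1 / M) := by gcongr
      _ = 1 / (n : ℝ) ^ 2 := by rw [hM]; field_simp

/-! ## Abstract conditional densities, affinity and the likelihood ratio test bound -/

/-- Positive conditional probability densities. -/
structure IsCondDens {d : ℕ} (p : Euc d → ℝ → ℝ) : Prop where
  meas : Measurable (Function.uncurry p)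
  pos : ∀ x y, 0 < p x y
  int : ∀ x, Integrable (p x)
  one : ∀ x, ∫ y, p x y = 1

namespace IsCondDens

variable {d : ℕ} {p q : Euc d → ℝ → ℝ} (μ : Measure (Euc d)) [IsProbabilityMeasure μ]

lemma integrable_prod (hp : IsCondDens p) :
    Integrable (Function.uncurry p) (μ.prod volume) := by
  rw [integrable_prod_iff hp.meas.aestronglyMeasurable]
  refine ⟨Filter.Eventually.of_forall fun x => hp.int x, ?_⟩
  have : (fun x => ∫ y, ‖Function.uncurry p (x, y)‖) = fun _ => (1 : ℝ) := by
    funext x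
    rw [← hp.one x]
    refine integral_congr_ae (Filter.Eventually.of_forall fun y => ?_)
    simp [Function.uncurry, abs_of_pos (hp.pos x y)]
  rw [this]
  exact integrable_const _

lemma isProb (hp : IsCondDens p) : IsProbabilityMeasure (jointMeasure μ p) := by
  constructor
  rw [jointMeasure, withDensity_apply _ MeasurableSet.univ, Measure.restrict_univ]
  have h := ofReal_integral_eq_lintegral_ofReal (hp.integrable_prod μ)
    (Filter.Eventually.of_forall fun z => (hp.pos z.1 z.2).le)
  have h' : ∫ z, Function.uncurry p z ∂(μ.prod volume) = 1 := by
    rw [integral_prod _ (hp.integrable_prod μ)]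
    simp [Function.uncurry, hp.one]
  rw [h'] at h
  simpa [Function.uncurry] using h.symm

lemma sqrt_mul_le (hp : IsCondDens p) (hq : IsCondDens q) (x : Euc d) (y : ℝ) :
    √(q x y * p x y) ≤ p x y + q x y := by
  have h1 := hp.pos x y
  have h2 := hq.pos x y
  rw [Real.sqrt_le_left (by positivity)]
  nlinarith

lemma int_sqrt (hp : IsCondDens p) (hq : IsCondDens q) (x : Euc d) :
    Integrable (fun y => √(q x y * p x y)) := by
  refine ((hp.int x).add (hq.int x)).mono' ?_ (Filter.Eventually.of_forall fun y => ?_)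
  · have h1 : Measurable (p x) := hp.meas.comp (measurable_const.prodMk measurable_id)
    have h2 : Measurable (q x) := hq.meas.comp (measurable_const.prodMk measurable_id)
    exact (h2.mul h1).sqrt.aestronglyMeasurable
  · rw [Real.norm_eq_abs, abs_of_nonneg (Real.sqrt_nonneg _)]
    exact hp.sqrt_mul_le hq x y

lemma int_sqrt_prod (hp : IsCondDens p) (hq : IsCondDens q) :
    Integrable (fun z : Euc d × ℝ => √(q z.1 z.2 * p z.1 z.2)) (μ.prod volume) := by
  refine ((hp.integrable_prod μ).add (hq.integrable_prod μ)).mono' ?_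
    (Filter.Eventually.of_forall fun z => ?_)
  · exact (hq.meas.mul hp.meas).sqrt.aestronglyMeasurable
  · rw [Real.norm_eq_abs, abs_of_nonneg (Real.sqrt_nonneg _)]
    exact hp.sqrt_mul_le hq z.1 z.2

lemma hell_sq (hp : IsCondDens p) (hq : IsCondDens q) (x : Euc d) :
    hellingerDist (q x) (p x) ^ 2 = 1 - ∫ y, √(q x y * p x y) := by
  rw [hellingerDist, Real.sq_sqrt]
  · have : (fun y => (√(q x y) - √(p x y)) ^ 2) =
        fun y => (q x y + p x y) - 2 * √(q x y * p x y) := by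
      funext y
      rw [Real.sqrt_mul (hq.pos x y).le, sub_sq, Real.sq_sqrt (hq.pos x y).le,
        Real.sq_sqrt (hp.pos x y).le]
      ring
    have h2 : ∫ y, (q x y + p x y) = 2 := by
      rw [integral_add (hq.int x) (hp.int x), hp.one, hq.one]; norm_num
    have h3 : Integrable (fun y => q x y + p x y) := (hq.int x).add (hp.int x)
    rw [this, integral_sub h3 ((hp.int_sqrt hq x).const_mul 2), integral_const_mul, h2]
    ring
  · have : 0 ≤ ∫ y, (√(q x y) - √(p x y)) ^ 2 := integral_nonneg fun y => sq_nonneg _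
    positivity

lemma hell_le_one (hp : IsCondDens p) (hq : IsCondDens q) (x : Euc d) :
    hellingerDist (q x) (p x) ≤ 1 := by
  have h := hp.hell_sq hq x
  have h2 : 0 ≤ ∫ y, √(q x y * p x y) := integral_nonneg fun y => Real.sqrt_nonneg _
  nlinarith

lemma hell_meas (hp : IsCondDens p) (hq : IsCondDens q) :
    StronglyMeasurable (fun x => hellingerDist (q x) (p x)) := by
  have h : StronglyMeasurable (fun x => ∫ y, (√(q x y) - √(p x y)) ^ 2) := by
    apply StronglyMeasurable.integral_prod_right
    exact ((hq.meas.sqrt.sub hp.meas.sqrt).pow_const 2).stronglyMeasurable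
  exact ((h.measurable.const_mul (1 / 2)).sqrt).stronglyMeasurable

lemma hell_int (hp : IsCondDens p) (hq : IsCondDens q) :
    Integrable (fun x => hellingerDist (q x) (p x)) μ := by
  refine (integrable_const (1 : ℝ)).mono' (hp.hell_meas hq).aestronglyMeasurable
    (Filter.Eventually.of_forall fun x => ?_)
  have h0 : 0 ≤ hellingerDist (q x) (p x) := Real.sqrt_nonneg _
  rw [Real.norm_eq_abs, abs_of_nonneg h0]
  exact hp.hell_le_one hq x

lemma hell_sq_int (hp : IsCondDens p) (hq : IsCondDens q) :
    Integrable (fun x => hellingerDist (q x) (p x) ^ 2) μ := by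
  refine (integrable_const (1 : ℝ)).mono' ((hp.hell_meas hq).pow 2).aestronglyMeasurable
    (Filter.Eventually.of_forall fun x => ?_)
  have h0 : 0 ≤ hellingerDist (q x) (p x) := Real.sqrt_nonneg _
  rw [Real.norm_eq_abs, abs_of_nonneg (by positivity)]
  have := hp.hell_le_one hq x
  nlinarith

lemma jensen (hp : IsCondDens p) (hq : IsCondDens q) :
    (∫ x, hellingerDist (q x) (p x) ∂μ) ^ 2 ≤ ∫ x, hellingerDist (q x) (p x) ^ 2 ∂μ := by
  set c := ∫ x, hellingerDist (q x) (p x) ∂μ with hc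
  have h : 0 ≤ ∫ x, (hellingerDist (q x) (p x) - c) ^ 2 ∂μ := integral_nonneg fun x => sq_nonneg _
  have h' : (fun x => (hellingerDist (q x) (p x) - c) ^ 2) = fun x =>
      hellingerDist (q x) (p x) ^ 2 - (2 * c * hellingerDist (q x) (p x) - c ^ 2) := by
    funext x; ring
  have h3 : Integrable (fun x => 2 * c * hellingerDist (q x) (p x) - c ^ 2) μ :=
    ((hp.hell_int μ hq).const_mul _).sub (integrable_const _)
  rw [h', integral_sub (hp.hell_sq_int μ hq) h3,
    integral_sub ((hp.hell_int μ hq).const_mul _) (integrable_const _), integral_const_mul,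
    ← hc] at h
  simp at h
  nlinarith

lemma ratio_mul (hp : IsCondDens p) (z : Euc d × ℝ) :
    p z.1 z.2 * √(q z.1 z.2 / p z.1 z.2) = √(q z.1 z.2 * p z.1 z.2) := by
  have h := hp.pos z.1 z.2
  conv_lhs => rw [← Real.sqrt_sq h.le, Real.sqrt_sq h.le]
  rw [← Real.sqrt_sq h.le, Real.sqrt_sq h.le, ← Real.sqrt_sq h.le, ← Real.sqrt_mul (by positivity),
    Real.sqrt_sq h.le]
  congr 1
  field_simp

lemma meas' (hp : IsCondDens p) :
    Measurable (fun z : Euc d × ℝ => ENNReal.ofReal (p z.1 z.2)) :=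
  hp.meas.ennreal_ofReal

lemma integrable_ratio (hp : IsCondDens p) (hq : IsCondDens q) :
    Integrable (fun z : Euc d × ℝ => √(q z.1 z.2 / p z.1 z.2)) (jointMeasure μ p) := by
  rw [jointMeasure, integrable_withDensity_iff hp.meas'
    (Filter.Eventually.of_forall fun z => ENNReal.ofReal_lt_top)]
  refine (hp.int_sqrt_prod μ hq).congr (Filter.Eventually.of_forall fun z => ?_)
  simp only
  rw [ENNReal.toReal_ofReal (hp.pos _ _).le, ← hp.ratio_mul, mul_comm]

lemma integral_ratio (hp : IsCondDens p) (hq : IsCondDens q) :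
    ∫ z, √(q z.1 z.2 / p z.1 z.2) ∂(jointMeasure μ p) ≤
      Real.exp (-(∫ x, hellingerDist (q x) (p x) ∂μ) ^ 2) := by
  have h1 : ∫ z, √(q z.1 z.2 / p z.1 z.2) ∂(jointMeasure μ p) =
      ∫ z, √(q z.1 z.2 * p z.1 z.2) ∂(μ.prod volume) := by
    rw [jointMeasure, integral_withDensity_eq_integral_toReal_smul hp.meas'
      (Filter.Eventually.of_forall fun z => ENNReal.ofReal_lt_top)]
    refine integral_congr_ae (Filter.Eventually.of_forall fun z => ?_)
    simp only [smul_eq_mul]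
    rw [ENNReal.toReal_ofReal (hp.pos _ _).le, hp.ratio_mul]
  rw [h1, integral_prod _ (hp.int_sqrt_prod μ hq)]
  have h2 : (fun x => ∫ y, √(q x y * p x y)) = fun x => 1 - hellingerDist (q x) (p x) ^ 2 := by
    funext x; rw [hp.hell_sq hq]; ring
  simp only
  rw [h2, integral_sub (integrable_const _) (hp.hell_sq_int μ hq)]
  have h3 := hp.jensen μ hq
  have h4 := Real.add_one_le_exp (-(∫ x, hellingerDist (q x) (p x) ∂μ) ^ 2)
  simp
  linarith

/-- Markov bound for the likelihood ratio test. -/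
lemma test_bound (hp : IsCondDens p) (hq : IsCondDens q) (n : ℕ) (ε : ℝ) (hε : 0 ≤ ε)
    (h : ε ≤ ∫ x, hellingerDist (q x) (p x) ∂μ) :
    (Measure.pi fun _ : Fin n => jointMeasure μ p)
      {s | Real.exp (-1 / 2) ≤ ∏ i, √(q (s i).1 (s i).2 / p (s i).1 (s i).2)} ≤
      ENNReal.ofReal (Real.exp (1 / 2) * Real.exp (-(n * ε ^ 2))) := by
  have := hp.isProb μ
  set g : Euc d × ℝ → ℝ := fun z => √(q z.1 z.2 / p z.1 z.2) with hg
  have hgi : Integrable g (jointMeasure μ p) := hp.integrable_ratio μ hq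
  have hI : Integrable (fun s : Fin n → Euc d × ℝ => ∏ i, g (s i))
      (Measure.pi fun _ : Fin n => jointMeasure μ p) :=
    Integrable.fintype_prod (f := fun _ => g) (fun _ => hgi)
  have hM := mul_meas_ge_le_integral_of_nonneg
    (Filter.Eventually.of_forall fun s => Finset.prod_nonneg fun i _ => Real.sqrt_nonneg _) hI
    (Real.exp (-1 / 2))
  rw [integral_fintype_prod_eq_pow g, Fintype.card_fin] at hM
  have h1 : (∫ z, g z ∂(jointMeasure μ p)) ^ n ≤ Real.exp (-(n * ε ^ 2)) := by
    calc (∫ z, g z ∂(jointMeasure μ p)) ^ n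
        ≤ (Real.exp (-(∫ x, hellingerDist (q x) (p x) ∂μ) ^ 2)) ^ n :=
          pow_le_pow_left₀ (integral_nonneg fun z => Real.sqrt_nonneg _)
            (hp.integral_ratio μ hq) n
      _ ≤ (Real.exp (-ε ^ 2)) ^ n := by gcongr
      _ = Real.exp (-(n * ε ^ 2)) := by rw [← Real.exp_nat_mul]; congr 1; ring
  have h2 := hM.trans h1
  rw [← ofReal_measureReal]
  apply ENNReal.ofReal_le_ofReal
  have h3 : Real.exp (1 / 2) * Real.exp (-1 / 2) = 1 := by
    rw [← Real.exp_add]; norm_num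
  have h4 := mul_le_mul_of_nonneg_left h2 (Real.exp_pos (1 / 2)).le
  rw [← mul_assoc, h3, one_mul] at h4
  exact h4

end IsCondDens

/-! ## Softmax weights -/

lemma smx_pos {k : ℕ} (f : Fin k → ℝ) (i : Fin k) :
    0 < Real.exp (f i) / ∑ j, Real.exp (f j) := by
  have : 0 < ∑ j, Real.exp (f j) := Finset.sum_pos (fun j _ => Real.exp_pos _) ⟨i, Finset.mem_univ _⟩
  have := Real.exp_pos (f i)
  positivity

lemma smx_sum {k : ℕ} (hk : 1 ≤ k) (f : Fin k → ℝ) :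
    ∑ i, (Real.exp (f i) / ∑ j, Real.exp (f j)) = 1 := by
  rw [← Finset.sum_div]
  have : 0 < ∑ j, Real.exp (f j) :=
    Finset.sum_pos (fun j _ => Real.exp_pos _) ⟨⟨0, hk⟩, Finset.mem_univ _⟩
  exact div_self this.ne'

lemma smx_comb_le {k : ℕ} (hk : 1 ≤ k) (f c : Fin k → ℝ) (B : ℝ) (hc : ∀ i, c i ≤ B) :
    ∑ i, (Real.exp (f i) / ∑ j, Real.exp (f j)) * c i ≤ B := by
  calc ∑ i, (Real.exp (f i) / ∑ j, Real.exp (f j)) * c i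
      ≤ ∑ i, (Real.exp (f i) / ∑ j, Real.exp (f j)) * B :=
        Finset.sum_le_sum fun i _ => mul_le_mul_of_nonneg_left (hc i) (smx_pos f i).le
    _ = B := by rw [← Finset.sum_mul, smx_sum hk, one_mul]

lemma smx_comb_pos {k : ℕ} (hk : 1 ≤ k) (f c : Fin k → ℝ) (hc : ∀ i, 0 < c i) :
    0 < ∑ i, (Real.exp (f i) / ∑ j, Real.exp (f j)) * c i :=
  Finset.sum_pos (fun i _ => mul_pos (smx_pos f i) (hc i)) ⟨⟨0, hk⟩, Finset.mem_univ _⟩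

lemma smx_ratio {k : ℕ} (f g : Fin k → ℝ) (t : ℝ) (h : ∀ i, |f i - g i| ≤ t) (i : Fin k) :
    Real.exp (f i) / ∑ j, Real.exp (f j) ≤
      Real.exp (2 * t) * (Real.exp (g i) / ∑ j, Real.exp (g j)) := by
  have hf : 0 < ∑ j, Real.exp (f j) :=
    Finset.sum_pos (fun j _ => Real.exp_pos _) ⟨i, Finset.mem_univ _⟩
  have hg : 0 < ∑ j, Real.exp (g j) :=
    Finset.sum_pos (fun j _ => Real.exp_pos _) ⟨i, Finset.mem_univ _⟩
  have h1 : Real.exp (f i) ≤ Real.exp t * Real.exp (g i) := by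
    rw [← Real.exp_add, Real.exp_le_exp]
    linarith [(abs_le.1 (h i)).2]
  have h2 : ∑ j, Real.exp (g j) ≤ Real.exp t * ∑ j, Real.exp (f j) := by
    rw [Finset.mul_sum]
    refine Finset.sum_le_sum fun j _ => ?_
    rw [← Real.exp_add, Real.exp_le_exp]
    linarith [(abs_le.1 (h j)).1]
  rw [← mul_div_assoc, div_le_div_iff₀ hf hg]
  calc Real.exp (f i) * ∑ j, Real.exp (g j)
      ≤ (Real.exp t * Real.exp (g i)) * (Real.exp t * ∑ j, Real.exp (f j)) := by gcongr
    _ = _ := by rw [two_mul, Real.exp_add]; ring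

lemma smx_comb_ratio {k : ℕ} (f g A B : Fin k → ℝ) (t c : ℝ) (h : ∀ i, |f i - g i| ≤ t)
    (hB : ∀ i, 0 ≤ A i) (hAB : ∀ i, A i ≤ Real.exp c * B i) :
    ∑ i, (Real.exp (f i) / ∑ j, Real.exp (f j)) * A i ≤
      Real.exp (2 * t + c) * ∑ i, (Real.exp (g i) / ∑ j, Real.exp (g j)) * B i := by
  rw [Finset.mul_sum]
  refine Finset.sum_le_sum fun i _ => ?_
  have h1 := smx_ratio f g t h i
  calc (Real.exp (f i) / ∑ j, Real.exp (f j)) * A i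
      ≤ (Real.exp (2 * t) * (Real.exp (g i) / ∑ j, Real.exp (g j))) * (Real.exp c * B i) :=
        mul_le_mul h1 (hAB i) (hB i) (mul_nonneg (Real.exp_pos _).le (smx_pos g i).le)
    _ = _ := by rw [Real.exp_add]; ring

/-! ## Gaussian facts -/

lemma gaussPDF_eq (m v : ℝ) (hv : 0 < v) :
    gaussPDF m v = ProbabilityTheory.gaussianPDFReal m v.toNNReal := by
  funext y
  simp [gaussPDF, ProbabilityTheory.gaussianPDFReal, Real.coe_toNNReal v hv.le]

lemma gaussPDF_pos (m v y : ℝ) (hv : 0 < v) : 0 < gaussPDF m v y := by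
  rw [gaussPDF]; have := Real.pi_pos; positivity

lemma gaussPDF_int (m v : ℝ) (hv : 0 < v) : Integrable (gaussPDF m v) := by
  rw [gaussPDF_eq m v hv]
  exact ProbabilityTheory.integrable_gaussianPDFReal _ _

lemma gaussPDF_one (m v : ℝ) (hv : 0 < v) : ∫ y, gaussPDF m v y = 1 := by
  rw [gaussPDF_eq m v hv]
  exact ProbabilityTheory.integral_gaussianPDFReal_eq_one _ (by simpa using hv)

lemma gaussPDF_sq (m v : ℝ) (hv : 0 < v) :
    Integrable (fun y => gaussPDF m v y * y ^ 2) ∧ ∫ y, gaussPDF m v y * y ^ 2 = m ^ 2 + v := by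
  have hv' : v.toNNReal ≠ 0 := by simpa using hv
  have hL := ProbabilityTheory.memLp_id_gaussianReal (μ := m) (v := v.toNNReal) 2
  have hvar := ProbabilityTheory.variance_eq_sub hL
  rw [ProbabilityTheory.variance_id_gaussianReal] at hvar
  simp only [id, ProbabilityTheory.integral_id_gaussianReal] at hvar
  have hi : Integrable (fun y : ℝ => y ^ 2) (ProbabilityTheory.gaussianReal m v.toNNReal) :=
    hL.integrable_sq
  constructor
  · rw [ProbabilityTheory.gaussianReal_of_var_ne_zero _ hv', integrable_withDensity_iff
      (ProbabilityTheory.measurable_gaussianPDF _ _)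
      (Filter.Eventually.of_forall fun z => ProbabilityTheory.gaussianPDF_lt_top)] at hi
    refine hi.congr (Filter.Eventually.of_forall fun y => ?_)
    simp only
    rw [ProbabilityTheory.toReal_gaussianPDF, gaussPDF_eq m v hv, mul_comm]
  · have h := ProbabilityTheory.integral_gaussianReal_eq_integral_smul (μ := m) hv'
      (f := fun y : ℝ => y ^ 2)
    rw [gaussPDF_eq m v hv]
    simp only [smul_eq_mul] at h
    rw [← h]
    have e : ∫ x, ((id : ℝ → ℝ) ^ 2) x ∂ProbabilityTheory.gaussianReal m v.toNNReal =
      ∫ x, x ^ 2 ∂ProbabilityTheory.gaussianReal m v.toNNReal := rfl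
    rw [e] at hvar
    have hcoe := Real.coe_toNNReal v hv.le
    rw [hcoe] at hvar
    linarith

lemma gauss_ratio (v0 R δ r m m' v v' y : ℝ) (hv0 : 0 < v0) (hR : 0 ≤ R) (hδ : 0 ≤ δ) (hr : 0 ≤ r)
    (hv : v0 ≤ v) (hv' : v0 ≤ v') (hvv : |v - v'| ≤ δ) (hmm : |m - m'| ≤ δ * (1 + r))
    (hm : |m| ≤ R * (1 + r)) (hm' : |m'| ≤ R * (1 + r)) :
    gaussPDF m v y ≤ Real.exp (((2 + R) / v0 + (1 + R ^ 2) / v0 ^ 2) * δ * ((1 + r) ^ 2 + y ^ 2)) *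
      gaussPDF m' v' y := by
  have hvp : 0 < v := hv0.trans_le hv
  have hvp' : 0 < v' := hv0.trans_le hv'
  set F := (1 + r) ^ 2 + y ^ 2 with hF
  have hF1 : 1 ≤ F := by nlinarith [sq_nonneg y, sq_nonneg r]
  have hpi := Real.pi_pos
  -- normalising constant
  have h1 : (√(2 * Real.pi * v))⁻¹ ≤ Real.exp (δ / v0 / 2) * (√(2 * Real.pi * v'))⁻¹ := by
    have hb : v' ≤ Real.exp (δ / v0) * v := by
      have h2 : δ / v0 + 1 ≤ Real.exp (δ / v0) := Real.add_one_le_exp _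
      have h3 : v' ≤ v + δ := by linarith [(abs_le.1 hvv).1]
      have h4 : δ ≤ δ / v0 * v := by
        rw [div_mul_eq_mul_div, le_div_iff₀ hv0]; gcongr
      nlinarith
    have hc : √(2 * Real.pi * v') ≤ Real.exp (δ / v0 / 2) * √(2 * Real.pi * v) := by
      rw [Real.exp_half, ← Real.sqrt_mul (Real.exp_pos _).le]
      apply Real.sqrt_le_sqrt
      nlinarith
    rw [← div_eq_mul_inv, le_div_iff₀ (by positivity), inv_mul_le_iff₀ (by positivity)]
    rw [mul_comm (√_)]
    exact hc
  have h2 : -(y - m) ^ 2 / (2 * v) ≤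
      ((1 + R) / v0 + (1 + R ^ 2) / v0 ^ 2) * δ * F + -(y - m') ^ 2 / (2 * v') := by
    have e : -(y - m) ^ 2 / (2 * v) = (m - m') * (2 * y - m - m') / (2 * v) +
        (y - m') ^ 2 * (v - v') / (2 * (v * v')) + -(y - m') ^ 2 / (2 * v') := by
      field_simp; ring
    have hA : (m - m') * (2 * y - m - m') / (2 * v) ≤ (1 + R) / v0 * δ * F := by
      have a1 : |2 * y - m - m'| ≤ 2 * |y| + 2 * (R * (1 + r)) := by
        calc |2 * y - m - m'| ≤ |2 * y| + |m| + |m'| := by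
              refine (abs_sub _ _).trans ?_; gcongr; exact abs_sub _ _
          _ ≤ _ := by rw [abs_mul, abs_two]; linarith
      have a2 : (m - m') * (2 * y - m - m') ≤
          (δ * (1 + r)) * (2 * |y| + 2 * (R * (1 + r))) := by
        refine (le_abs_self _).trans ?_
        rw [abs_mul]
        gcongr
      have a3 : (1 + r) * (2 * |y| + 2 * (R * (1 + r))) ≤ 2 * ((1 + R) * F) := by
        rw [hF]
        nlinarith [sq_nonneg (1 + r - |y|), sq_abs y, mul_nonneg hR (sq_nonneg y), sq_nonneg (1 + r), sq_nonneg y]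
      have a4 : (m - m') * (2 * y - m - m') ≤ 2 * ((1 + R) * δ * F) := by
        nlinarith
      calc (m - m') * (2 * y - m - m') / (2 * v) ≤ 2 * ((1 + R) * δ * F) / (2 * v) := by gcongr
        _ ≤ 2 * ((1 + R) * δ * F) / (2 * v0) := by gcongr
        _ = _ := by field_simp
    have hB : (y - m') ^ 2 * (v - v') / (2 * (v * v')) ≤ (1 + R ^ 2) / v0 ^ 2 * δ * F := by
      have b1 : (y - m') ^ 2 ≤ 2 * ((1 + R ^ 2) * F) := by
        have : m' ^ 2 ≤ (R * (1 + r)) ^ 2 := by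
          rw [← sq_abs m']; gcongr
        rw [hF]
        nlinarith [sq_nonneg (y + m'), mul_nonneg (sq_nonneg R) (sq_nonneg y), sq_nonneg (1 + r)]
      have b2 : (y - m') ^ 2 * (v - v') ≤ 2 * ((1 + R ^ 2) * F) * δ := by
        calc (y - m') ^ 2 * (v - v') ≤ (y - m') ^ 2 * δ := by
              gcongr; exact (le_abs_self _).trans hvv
          _ ≤ _ := by gcongr
      have b3 : v0 ^ 2 ≤ v * v' := by nlinarith
      calc (y - m') ^ 2 * (v - v') / (2 * (v * v'))
          ≤ 2 * ((1 + R ^ 2) * F) * δ / (2 * (v * v')) := by gcongr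
        _ ≤ 2 * ((1 + R ^ 2) * F) * δ / (2 * v0 ^ 2) := by gcongr
        _ = _ := by field_simp
    rw [e]
    linarith
  have h3 : δ / v0 / 2 ≤ 1 / v0 * δ * F := by
    have : 0 ≤ δ / v0 := by positivity
    have h : 1 / v0 * δ * F = δ / v0 * F := by ring
    rw [h]; nlinarith
  rw [gaussPDF, gaussPDF]
  calc (√(2 * Real.pi * v))⁻¹ * Real.exp (-(y - m) ^ 2 / (2 * v))
      ≤ (Real.exp (1 / v0 * δ * F) * (√(2 * Real.pi * v'))⁻¹) *
        Real.exp (((1 + R) / v0 + (1 + R ^ 2) / v0 ^ 2) * δ * F + -(y - m') ^ 2 / (2 * v')) := by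
        gcongr
        exact h1.trans (by gcongr)
    _ = _ := by
        rw [Real.exp_add]
        have : ((2 + R) / v0 + (1 + R ^ 2) / v0 ^ 2) * δ * F =
          1 / v0 * δ * F + ((1 + R) / v0 + (1 + R ^ 2) / v0 ^ 2) * δ * F := by ring
        rw [this, Real.exp_add]; ring

/-! ## Facts about the Laplace–Laplace HMoE density -/

lemma comb_integral {k : ℕ} (w : Fin k → ℝ) (A : Fin k → ℝ → ℝ) (h : ∀ i, Integrable (A i)) :
    Integrable (fun y => ∑ i, w i * A i y) ∧
      ∫ y, ∑ i, w i * A i y = ∑ i, w i * ∫ y, A i y := by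
  refine ⟨integrable_finsetSum _ fun i _ => (h i).const_mul _, ?_⟩
  rw [integral_finsetSum _ fun i _ => (h i).const_mul _]
  simp [integral_const_mul]

lemma pLL_cond {d k1 k2 : ℕ} (P : HMoE d k1 k2) (hk1 : 1 ≤ k1) (hk2 : 1 ≤ k2)
    (hν : ∀ i j, 0 < P.ν i j) : IsCondDens (pLL P) := by
  have key : ∀ x, Integrable (pLL P x) ∧ ∫ y, pLL P x y = 1 := by
    intro x
    have h1 : ∀ i1, _ := fun i1 => comb_integral
      (fun i2 => Real.exp (-‖P.ω i1 i2 - x‖ + P.β i1 i2) /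
        ∑ j2, Real.exp (-‖P.ω i1 j2 - x‖ + P.β i1 j2))
      (fun i2 => gaussPDF (⟪P.η i1 i2, x⟫ + P.τ i1 i2) (P.ν i1 i2))
      (fun i2 => gaussPDF_int _ _ (hν i1 i2))
    have h2 := comb_integral (fun i1 => Real.exp (-‖P.a i1 - x‖ + P.b i1) /
      ∑ j1, Real.exp (-‖P.a j1 - x‖ + P.b j1)) _ (fun i1 => (h1 i1).1)
    refine ⟨h2.1, h2.2.trans ?_⟩
    simp only [(h1 _).2, gaussPDF_one _ _ (hν _ _), mul_one]
    simp only [smx_sum hk2 (fun j2 => -‖P.ω _ j2 - x‖ + P.β _ j2), mul_one]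
    exact smx_sum hk1 (fun j1 => -‖P.a j1 - x‖ + P.b j1)
  refine ⟨?_, ?_, fun x => (key x).1, fun x => (key x).2⟩
  · unfold pLL gaussPDF Function.uncurry
    fun_prop
  · intro x y
    exact smx_comb_pos hk1 (fun j1 => -‖P.a j1 - x‖ + P.b j1) _ fun i1 =>
      smx_comb_pos hk2 (fun j2 => -‖P.ω i1 j2 - x‖ + P.β i1 j2) _ fun i2 =>
        gaussPDF_pos _ _ _ (hν i1 i2)

lemma pLL_sq {d k1 k2 : ℕ} (P : HMoE d k1 k2) (hk1 : 1 ≤ k1) (hk2 : 1 ≤ k2)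
    (hν : ∀ i j, 0 < P.ν i j) (x : Euc d) (B : ℝ)
    (hB : ∀ i j, (⟪P.η i j, x⟫ + P.τ i j) ^ 2 + P.ν i j ≤ B) :
    Integrable (fun y => pLL P x y * y ^ 2) ∧ ∫ y, pLL P x y * y ^ 2 ≤ B := by
  have h1 : ∀ i1, _ := fun i1 => comb_integral
    (fun i2 => Real.exp (-‖P.ω i1 i2 - x‖ + P.β i1 i2) /
      ∑ j2, Real.exp (-‖P.ω i1 j2 - x‖ + P.β i1 j2))
    (fun i2 y => gaussPDF (⟪P.η i1 i2, x⟫ + P.τ i1 i2) (P.ν i1 i2) y * y ^ 2)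
    (fun i2 => (gaussPDF_sq _ _ (hν i1 i2)).1)
  have h2 := comb_integral (fun i1 => Real.exp (-‖P.a i1 - x‖ + P.b i1) /
    ∑ j1, Real.exp (-‖P.a j1 - x‖ + P.b j1)) _ (fun i1 => (h1 i1).1)
  have e : (fun y => pLL P x y * y ^ 2) = fun y =>
      ∑ i1, (Real.exp (-‖P.a i1 - x‖ + P.b i1) / ∑ j1, Real.exp (-‖P.a j1 - x‖ + P.b j1)) *
      ∑ i2, (Real.exp (-‖P.ω i1 i2 - x‖ + P.β i1 i2) /
        ∑ j2, Real.exp (-‖P.ω i1 j2 - x‖ + P.β i1 j2)) *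
      (gaussPDF (⟪P.η i1 i2, x⟫ + P.τ i1 i2) (P.ν i1 i2) y * y ^ 2) := by
    funext y
    simp only [pLL, Finset.sum_mul, mul_assoc]
  rw [e]
  refine ⟨h2.1, h2.2.trans_le ?_⟩
  simp only [(h1 _).2, (gaussPDF_sq _ _ (hν _ _)).2]
  exact smx_comb_le hk1 (fun j1 => -‖P.a j1 - x‖ + P.b j1) _ B fun i1 =>
    smx_comb_le hk2 (fun j2 => -‖P.ω i1 j2 - x‖ + P.β i1 j2) _ B fun i2 => hB i1 i2

/-- The parameter tuple of expert `(i, j)`. -/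
def tup {d k1 k2 : ℕ} (P : HMoE d k1 k2) (i : Fin k1) (j : Fin k2) :
    ℝ × Euc d × ℝ × Euc d × Euc d × ℝ × ℝ :=
  (P.b i, P.a i, P.β i j, P.ω i j, P.η i j, P.τ i j, P.ν i j)

lemma tup_norm_le {d : ℕ} (θ : ℝ × Euc d × ℝ × Euc d × Euc d × ℝ × ℝ) (M : ℝ) (h : ‖θ‖ ≤ M) :
    |θ.1| ≤ M ∧ ‖θ.2.1‖ ≤ M ∧ |θ.2.2.1| ≤ M ∧ ‖θ.2.2.2.1‖ ≤ M ∧ ‖θ.2.2.2.2.1‖ ≤ M ∧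
      |θ.2.2.2.2.2.1| ≤ M ∧ |θ.2.2.2.2.2.2| ≤ M := by
  simpa only [Prod.norm_def, sup_le_iff, Real.norm_eq_abs] using h

lemma mean_abs_le {d : ℕ} (u x : Euc d) (t M : ℝ) (hu : ‖u‖ ≤ M) (ht : |t| ≤ M) :
    |⟪u, x⟫ + t| ≤ M * (1 + ‖x‖) := by
  have h1 := abs_real_inner_le_norm u x
  have h2 := abs_add_le (⟪u, x⟫) t
  have h3 : ‖u‖ * ‖x‖ ≤ M * ‖x‖ := by gcongr
  linarith

lemma gate_abs_le {d : ℕ} (a a' x : Euc d) (b b' δ : ℝ) (ha : ‖a - a'‖ ≤ δ) (hb : |b - b'| ≤ δ) :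
    |(-‖a - x‖ + b) - (-‖a' - x‖ + b')| ≤ 2 * δ := by
  have h1 := abs_norm_sub_norm_le (a - x) (a' - x)
  rw [sub_sub_sub_cancel_right] at h1
  have h2 := abs_le.1 (h1.trans ha)
  have h3 := abs_le.1 hb
  rw [abs_le]
  constructor <;> linarith [h2.1, h2.2, h3.1, h3.2]

lemma pLL_ratio {d k1 k2 : ℕ} (P P' : HMoE d k1 k2) (hk2 : 1 ≤ k2) (v0 M δ : ℝ) (hv0 : 0 < v0)
    (hM : 0 ≤ M) (hδ : 0 ≤ δ) (hv : ∀ i j, v0 ≤ P.ν i j) (hv' : ∀ i j, v0 ≤ P'.ν i j)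
    (hP : ∀ i j, ‖tup P i j‖ ≤ M) (hP' : ∀ i j, ‖tup P' i j‖ ≤ M)
    (hPP : ∀ i j, ‖tup P i j - tup P' i j‖ ≤ δ) (x : Euc d) (y : ℝ) :
    pLL P x y ≤ Real.exp (((2 + M) / v0 + (1 + M ^ 2) / v0 ^ 2 + 8) * δ *
      ((1 + ‖x‖) ^ 2 + y ^ 2)) * pLL P' x y := by
  set L := (2 + M) / v0 + (1 + M ^ 2) / v0 ^ 2 with hL
  set F := (1 + ‖x‖) ^ 2 + y ^ 2 with hF
  have hF1 : 1 ≤ F := by nlinarith [sq_nonneg y, sq_nonneg ‖x‖, norm_nonneg x]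
  have hpos' : ∀ i j, 0 < P.ν i j := fun i j => hv0.trans_le (hv i j)
  have hpos : ∀ i j, 0 < P'.ν i j := fun i j => hv0.trans_le (hv' i j)
  have key : pLL P x y ≤ Real.exp (2 * (2 * δ) + (2 * (2 * δ) + L * δ * F)) * pLL P' x y := by
    refine smx_comb_ratio (fun j1 => -‖P.a j1 - x‖ + P.b j1) (fun j1 => -‖P'.a j1 - x‖ + P'.b j1)
      _ _ _ _ (fun i => ?_) (fun i => ?_) (fun i => ?_)
    · have h := tup_norm_le _ _ (hPP i ⟨0, hk2⟩)
      exact gate_abs_le _ _ _ _ _ _ h.2.1 h.1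
    · exact (smx_comb_pos hk2 (fun j2 => -‖P.ω i j2 - x‖ + P.β i j2) _ fun i2 =>
        gaussPDF_pos _ _ _ (hpos' i i2)).le
    · refine smx_comb_ratio (fun j2 => -‖P.ω i j2 - x‖ + P.β i j2)
        (fun j2 => -‖P'.ω i j2 - x‖ + P'.β i j2) _ _ _ _ (fun j => ?_) (fun j => ?_) (fun j => ?_)
      · have h := tup_norm_le _ _ (hPP i j)
        exact gate_abs_le _ _ _ _ _ _ h.2.2.2.1 h.2.2.1
      · exact (gaussPDF_pos _ _ _ (hpos' i j)).le
      · have h := tup_norm_le _ _ (hPP i j)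
        have h1 := tup_norm_le _ _ (hP i j)
        have h2 := tup_norm_le _ _ (hP' i j)
        refine gauss_ratio v0 M δ ‖x‖ _ _ _ _ y hv0 hM hδ (norm_nonneg x) (hv i j) (hv' i j)
          h.2.2.2.2.2.2 ?_ (mean_abs_le _ _ _ _ h1.2.2.2.2.1 h1.2.2.2.2.2.1)
          (mean_abs_le _ _ _ _ h2.2.2.2.2.1 h2.2.2.2.2.2.1)
        have h3 := mean_abs_le _ x _ _ h.2.2.2.2.1 h.2.2.2.2.2.1
        refine le_trans (le_of_eq ?_) h3
        simp only [tup, Prod.snd_sub, Prod.fst_sub, inner_sub_left]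
        congr 1
        ring
  refine key.trans ?_
  have hk : 0 ≤ pLL P' x y := Finset.sum_nonneg fun i1 _ =>
    mul_nonneg (smx_pos (fun j1 => -‖P'.a j1 - x‖ + P'.b j1) i1).le <| Finset.sum_nonneg fun i2 _ =>
    mul_nonneg (smx_pos (fun j2 => -‖P'.ω i1 j2 - x‖ + P'.β i1 j2) i2).le
      (gaussPDF_pos _ _ _ (hpos i1 i2)).le
  gcongr
  nlinarith

lemma cover_HMoE {d : ℕ} (k1 k2 : ℕ) (Θ : Set (ℝ × Euc d × ℝ × Euc d × Euc d × ℝ × ℝ))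
    (hΘ : Bornology.IsBounded Θ) :
    ∃ (K : ℝ) (D : ℕ), 0 < K ∧ ∀ A : Set (HMoE d k1 k2), (∀ P ∈ A, inParamSpace Θ P) →
      ∀ n : ℕ, 1 ≤ n →
      ∃ T : Finset (HMoE d k1 k2), (∀ t ∈ T, t ∈ A) ∧ (T.card : ℝ) ≤ K * (n : ℝ) ^ D ∧
        ∀ P ∈ A, ∃ t ∈ T, ∀ i j, ‖tup P i j - tup t i j‖ ≤ 1 / (n : ℝ) ^ 2 := by
  classical
  have hS : Bornology.IsBounded {z : Fin k1 → Fin k2 → ℝ × Euc d × ℝ × Euc d × Euc d × ℝ × ℝ |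
      ∀ i j, z i j ∈ Θ} := by
    obtain ⟨R, hR⟩ := hΘ.exists_norm_le
    refine isBounded_iff_forall_norm_le.2 ⟨max R 0, fun z hz => ?_⟩
    refine (pi_norm_le_iff_of_nonneg (le_max_right _ _)).2 fun i =>
      (pi_norm_le_iff_of_nonneg (le_max_right _ _)).2 fun j => (hR _ (hz i j)).trans (le_max_left _ _)
  obtain ⟨K, D, hK, h⟩ := exists_cover _ hS
  refine ⟨K, D, hK, fun A hA n hn => ?_⟩
  obtain ⟨T, hT1, hT2, hT3⟩ := h ((fun P => tup P) '' A)
    (by rintro _ ⟨P, hP, rfl⟩; exact hA P hP) n hn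
  have hc : ∀ t : T, ∃ P ∈ A, tup P = t := fun t => hT1 t t.2
  choose g hgA hg using hc
  refine ⟨Finset.univ.image g, ?_, ?_, ?_⟩
  · intro t ht
    obtain ⟨z, -, rfl⟩ := Finset.mem_image.1 ht
    exact hgA z
  · refine le_trans ?_ hT2
    have : (Finset.univ.image g).card ≤ T.card :=
      Finset.card_image_le.trans (by simp)
    exact_mod_cast this
  · intro P hP
    obtain ⟨t, ht, hle⟩ := hT3 _ ⟨P, hP, rfl⟩
    refine ⟨g ⟨t, ht⟩, Finset.mem_image_of_mem _ (Finset.mem_univ _), fun i j => ?_⟩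
    have e : tup (g ⟨t, ht⟩) = t := hg ⟨t, ht⟩
    rw [e]
    have h1 := norm_le_pi_norm (tup P - t) i
    have h2 := norm_le_pi_norm ((tup P - t) i) j
    exact h2.trans (h1.trans hle)

/-- Integrability of the envelope. -/
lemma moment_bound {d k1 k2 : ℕ} (P : HMoE d k1 k2) (hk1 : 1 ≤ k1) (hk2 : 1 ≤ k2)
    (hν : ∀ i j, 0 < P.ν i j) (M : ℝ) (hM : 0 ≤ M) (hP : ∀ i j, ‖tup P i j‖ ≤ M)
    (μ : Measure (Euc d)) [IsProbabilityMeasure μ]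
    (hμ : ∃ s : Set (Euc d), Bornology.IsBounded s ∧ μ sᶜ = 0) :
    ∃ C : ℝ, 0 ≤ C ∧ ∫⁻ z, ENNReal.ofReal ((1 + ‖z.1‖) ^ 2 + z.2 ^ 2) ∂(jointMeasure μ (pLL P)) ≤
      ENNReal.ofReal C := by
  obtain ⟨s, hs, hsμ⟩ := hμ
  obtain ⟨R0, hR0⟩ := hs.exists_norm_le
  set R := max R0 0 with hR
  have hRn : 0 ≤ R := le_max_right _ _
  have hp := pLL_cond P hk1 hk2 hν
  refine ⟨(1 + R) ^ 2 + ((M * (1 + R)) ^ 2 + M), by positivity, ?_⟩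
  have hFm : Measurable (fun z : Euc d × ℝ => ENNReal.ofReal ((1 + ‖z.1‖) ^ 2 + z.2 ^ 2)) := by
    fun_prop
  rw [jointMeasure, lintegral_withDensity_eq_lintegral_mul _ hp.meas' hFm,
    lintegral_prod _ (hp.meas'.mul hFm).aemeasurable]
  have hae : ∀ᵐ x ∂μ, x ∈ s := by
    rw [ae_iff]; exact hsμ
  calc _ ≤ ∫⁻ _x, ENNReal.ofReal ((1 + R) ^ 2 + ((M * (1 + R)) ^ 2 + M)) ∂μ := by
        refine lintegral_mono_ae ?_
        filter_upwards [hae] with x hx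
        have hxR : ‖x‖ ≤ R := (hR0 x hx).trans (le_max_left _ _)
        have hB : ∀ i j, (⟪P.η i j, x⟫ + P.τ i j) ^ 2 + P.ν i j ≤ (M * (1 + R)) ^ 2 + M := by
          intro i j
          have h := tup_norm_le _ _ (hP i j)
          have h1 := mean_abs_le _ x _ _ h.2.2.2.2.1 h.2.2.2.2.2.1
          have h2 : |⟪P.η i j, x⟫ + P.τ i j| ≤ M * (1 + R) := h1.trans (by gcongr)
          have h3 : P.ν i j ≤ M := (le_abs_self _).trans h.2.2.2.2.2.2
          have h4 : (⟪P.η i j, x⟫ + P.τ i j) ^ 2 ≤ (M * (1 + R)) ^ 2 := by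
            rw [← sq_abs]; gcongr
          linarith
        obtain ⟨hi, hle⟩ := pLL_sq P hk1 hk2 hν x _ hB
        have hi2 : Integrable (fun y => pLL P x y * (1 + ‖x‖) ^ 2 + pLL P x y * y ^ 2) :=
          ((hp.int x).mul_const _).add hi
        have e : (∫⁻ y, ((fun z : Euc d × ℝ => ENNReal.ofReal (pLL P z.1 z.2)) *
            fun z : Euc d × ℝ => ENNReal.ofReal ((1 + ‖z.1‖) ^ 2 + z.2 ^ 2)) (x, y)) =
            ENNReal.ofReal (∫ y, (pLL P x y * (1 + ‖x‖) ^ 2 + pLL P x y * y ^ 2)) := by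
          rw [ofReal_integral_eq_lintegral_ofReal hi2]
          · refine lintegral_congr fun y => ?_
            simp only [Pi.mul_apply]
            rw [← ENNReal.ofReal_mul (hp.pos x y).le, mul_add]
          · refine Filter.Eventually.of_forall fun y => ?_
            have := hp.pos x y
            simp only [Pi.zero_apply]
            positivity
        rw [e, integral_add ((hp.int x).mul_const _) hi, integral_mul_const, hp.one, one_mul]
        apply ENNReal.ofReal_le_ofReal
        gcongr
    _ = _ := by simp

lemma markov_sum {α : Type*} [MeasurableSpace α] (Q : Measure α) [IsProbabilityMeasure Q]
    (f : α → ℝ) (hf : Measurable f) (hf0 : ∀ z, 0 ≤ f z) (C κ : ℝ) (hκ : 0 ≤ κ)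
    (hC : ∫⁻ z, ENNReal.ofReal (f z) ∂Q ≤ ENNReal.ofReal C) (n : ℕ) :
    (Measure.pi fun _ : Fin n => Q) {s | 1 ≤ κ * ∑ i, f (s i)} ≤
      ENNReal.ofReal (n * (κ * C)) := by
  have hm : Measurable fun s : Fin n → α => ∑ i, ENNReal.ofReal (κ * f (s i)) := by fun_prop
  have h := mul_meas_ge_le_lintegral (μ := Measure.pi fun _ : Fin n => Q) hm 1
  rw [one_mul] at h
  have e : {s : Fin n → α | 1 ≤ κ * ∑ i, f (s i)} =
      {s | 1 ≤ ∑ i, ENNReal.ofReal (κ * f (s i))} := by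
    ext s
    simp only [Set.mem_ofPred_eq]
    rw [← ENNReal.ofReal_sum_of_nonneg fun i _ => mul_nonneg hκ (hf0 _), ← Finset.mul_sum,
      ENNReal.one_le_ofReal]
  rw [e]
  refine h.trans ?_
  rw [lintegral_finsetSum _ fun i _ => by fun_prop]
  have h1 : ∀ i : Fin n, ∫⁻ s, ENNReal.ofReal (κ * f (s i)) ∂(Measure.pi fun _ : Fin n => Q) ≤
      ENNReal.ofReal (κ * C) := by
    intro i
    have hmp := (measurePreserving_eval (fun _ : Fin n => Q) i).lintegral_comp
      (f := fun z => ENNReal.ofReal (κ * f z)) (by fun_prop)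
    simp only [Function.eval] at hmp
    rw [hmp]
    simp only [ENNReal.ofReal_mul hκ]
    rw [lintegral_const_mul _ (by fun_prop)]
    gcongr
  calc _ ≤ ∑ _i : Fin n, ENNReal.ofReal (κ * C) := Finset.sum_le_sum fun i _ => h1 i
    _ = _ := by
      rw [Finset.sum_const, Finset.card_univ, Fintype.card_fin, nsmul_eq_mul,
        ENNReal.ofReal_mul (Nat.cast_nonneg n), ENNReal.ofReal_natCast]

/-- Deterministic step: a near-maximiser of the likelihood passes the likelihood ratio test. -/
lemma lr_step {α : Type*} {n : ℕ} (s : Fin n → α) (p0 p q F : α → ℝ) (κ : ℝ)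
    (h0 : ∀ z, 0 < p0 z) (hp : ∀ z, 0 < p z) (hq : ∀ z, 0 < q z)
    (hpq : ∀ z, p z ≤ Real.exp (κ * F z) * q z)
    (hmle : ∑ i, Real.log (p0 (s i)) ≤ ∑ i, Real.log (p (s i)))
    (hF : κ * ∑ i, F (s i) < 1) :
    Real.exp (-1 / 2) ≤ ∏ i, √(q (s i) / p0 (s i)) := by
  have h1 : ∀ z, √(q z / p0 z) = Real.exp ((Real.log (q z) - Real.log (p0 z)) / 2) := by
    intro z
    rw [Real.exp_half, Real.exp_sub, Real.exp_log (hq z), Real.exp_log (h0 z)]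
  simp only [h1]
  rw [← Real.exp_sum, Real.exp_le_exp, ← Finset.sum_div, Finset.sum_sub_distrib]
  have h2 : ∑ i, Real.log (p (s i)) ≤ ∑ i, (κ * F (s i) + Real.log (q (s i))) := by
    refine Finset.sum_le_sum fun i _ => ?_
    have := Real.log_le_log (hp (s i)) (hpq (s i))
    rwa [Real.log_mul (Real.exp_pos _).ne' (hq _).ne', Real.log_exp] at this
  rw [Finset.sum_add_distrib, ← Finset.mul_sum] at h2
  linarith

/-- Density estimation rate for the MLE in the Laplace–Laplace Gaussian HMoE:
under (A.1)–(A.4), any maximum likelihood estimator `Ĝₙ` over `𝒢_{k₁*,k₂}(Θ)` (with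
`k₂ > k₂*`) satisfies
`ℙ( E_X[h(p^LL_{Ĝₙ}(·|X), p^LL_{G*}(·|X))] > C₁ √(log n / n) ) ≤ C₂ exp(−c₁ log n)`
for all `n ≥ 2`, for universal constants `C₁, c₁, C₂ > 0`. -/
theorem mle_density_rate_LL {d K1 K2 : ℕ} (k2 : ℕ)
    (Θ : Set (ℝ × Euc d × ℝ × Euc d × Euc d × ℝ × ℝ))
    -- (A.1): compact parameter space (with positive variances), bounded input support
    (hΘ : IsCompact Θ)
    (hΘν : ∀ θ ∈ Θ, 0 < θ.2.2.2.2.2.2)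
    (μ : Measure (Euc d)) [IsProbabilityMeasure μ]
    (hμ : ∃ s : Set (Euc d), Bornology.IsBounded s ∧ μ sᶜ = 0)
    -- true mixing measure, with k₁* = K1 + 1 groups and k₂* = K2 + 1 experts per group
    (Gs : HMoE d (K1 + 1) (K2 + 1))
    (hGs : inParamSpace Θ Gs)
    (hk2 : K2 + 1 < k2)
    -- (A.2): normalization for identifiability
    (hA2a : Gs.a (Fin.last K1) = 0) (hA2b : Gs.b (Fin.last K1) = 0)
    (hA2ω : ∀ i1, Gs.ω i1 (Fin.last K2) = 0) (hA2β : ∀ i1, Gs.β i1 (Fin.last K2) = 0)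
    -- (A.3): distinct expert parameters within each group
    (hA3 : ∀ i1, Function.Injective fun i2 => (Gs.η i1 i2, Gs.τ i1 i2, Gs.ν i1 i2))
    -- (A.4): input-dependent gating
    (hA4a : ∃ i1, Gs.a i1 ≠ 0) (hA4ω : ∃ i1 i2, Gs.ω i1 i2 ≠ 0)
    -- the estimator: a maximizer of the empirical log-likelihood over 𝒢_{k₁*,k₂}(Θ)
    (Ghat : (n : ℕ) → (Fin n → Euc d × ℝ) → Candidate d (K1 + 1))
    (hMLE : ∀ (n : ℕ) (s : Fin n → Euc d × ℝ),
      Ghat n s ∈ candClass d (K1 + 1) k2 Θ ∧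
      ∀ G ∈ candClass d (K1 + 1) k2 Θ,
        (1 / (n : ℝ)) * ∑ i, Real.log (pLL G.2 (s i).1 (s i).2) ≤
          (1 / (n : ℝ)) * ∑ i, Real.log (pLL (Ghat n s).2 (s i).1 (s i).2)) :
    ∃ C1 c1 C2 : ℝ, 0 < C1 ∧ 0 < c1 ∧ 0 < C2 ∧
      ∀ n : ℕ, 2 ≤ n →
        (Measure.pi fun _ : Fin n => jointMeasure μ (pLL Gs))
            {s | C1 * Real.sqrt (Real.log n / n) <
              ∫ x, hellingerDist (pLL (Ghat n s).2 x) (pLL Gs x) ∂μ} ≤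
          ENNReal.ofReal (C2 * Real.exp (-(c1 * Real.log n))) := by
  classical
  -- constants from compactness
  have hbd := hΘ.isBounded
  obtain ⟨M0, hM0⟩ := hbd.exists_norm_le
  set M := max M0 0 with hMdef
  have hM : 0 ≤ M := le_max_right _ _
  have hMΘ : ∀ θ ∈ Θ, ‖θ‖ ≤ M := fun θ hθ => (hM0 θ hθ).trans (le_max_left _ _)
  obtain ⟨v0, hv0, hv0Θ⟩ : ∃ v0 : ℝ, 0 < v0 ∧ ∀ θ ∈ Θ, v0 ≤ θ.2.2.2.2.2.2 := by
    have hne : Θ.Nonempty := ⟨_, hGs 0 0⟩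
    obtain ⟨θ, hθ, hmin⟩ := hΘ.exists_isMinOn hne
      (f := fun θ : ℝ × Euc d × ℝ × Euc d × Euc d × ℝ × ℝ => θ.2.2.2.2.2.2)
      (by fun_prop)
    exact ⟨_, hΘν θ hθ, fun θ' hθ' => hmin hθ'⟩
  have hpos : ∀ {k1 k' : ℕ} (P : HMoE d k1 k'), inParamSpace Θ P → ∀ i j, 0 < P.ν i j :=
    fun P hP i j => hΘν _ (hP i j)
  have hlow : ∀ {k1 k' : ℕ} (P : HMoE d k1 k'), inParamSpace Θ P → ∀ i j, v0 ≤ P.ν i j :=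
    fun P hP i j => hv0Θ _ (hP i j)
  have hnrm : ∀ {k1 k' : ℕ} (P : HMoE d k1 k'), inParamSpace Θ P → ∀ i j, ‖tup P i j‖ ≤ M :=
    fun P hP i j => hMΘ _ (hP i j)
  have hp0 : IsCondDens (pLL Gs) := pLL_cond Gs (by omega) (by omega) (hpos Gs hGs)
  have hprob := hp0.isProb μ
  obtain ⟨C, hC0, hC⟩ := moment_bound Gs (by omega) (by omega) (hpos Gs hGs) M hM
    (hnrm Gs hGs) μ hμ
  choose K D hK hcov using fun k' : ℕ => cover_HMoE (K1 + 1) k' Θ hbd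
  set L := (2 + M) / v0 + (1 + M ^ 2) / v0 ^ 2 + 8 with hL
  have hLpos : 0 < L := by positivity
  set Ds : ℕ := ∑ k' ∈ Finset.Icc 1 k2, D k' with hDs
  set Ks : ℝ := ∑ k' ∈ Finset.Icc 1 k2, K k' with hKs
  have hKs0 : 0 ≤ Ks := Finset.sum_nonneg fun k' _ => (hK k').le
  refine ⟨√(Ds + 1), 1, L * C + Real.exp (1 / 2) * Ks + 1, by positivity, one_pos, by positivity,
    fun n hn => ?_⟩
  have hn0 : (0 : ℝ) < n := by exact_mod_cast (by omega : 0 < n)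
  have hn1 : (1 : ℝ) ≤ n := by exact_mod_cast (by omega : 1 ≤ n)
  have hlog : 0 ≤ Real.log n := Real.log_nonneg hn1
  set ε := √((Ds : ℝ) + 1) * √(Real.log n / n) with hε
  have hε0 : 0 ≤ ε := by positivity
  have hnε : Real.exp (-(n * ε ^ 2)) = ((n : ℝ) ^ (Ds + 1))⁻¹ := by
    rw [hε, mul_pow, Real.sq_sqrt (by positivity), Real.sq_sqrt (by positivity), Real.exp_neg]
    congr 1
    have : (n : ℝ) * (((Ds : ℝ) + 1) * (Real.log n / n)) = ((Ds + 1 : ℕ) : ℝ) * Real.log n := by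
      push_cast; field_simp
    rw [this, Real.exp_nat_mul, Real.exp_log hn0]
  -- nets of the bad sets
  let bad : (k' : ℕ) → Set (HMoE d (K1 + 1) k') := fun k' =>
    {P | inParamSpace Θ P ∧ ε ≤ ∫ x, hellingerDist (pLL P x) (pLL Gs x) ∂μ}
  choose T hT1 hT2 hT3 using fun k' : ℕ => hcov k' (bad k') (fun P hP => hP.1) n (by omega)
  set Q := jointMeasure μ (pLL Gs) with hQ
  let F : Euc d × ℝ → ℝ := fun z => (1 + ‖z.1‖) ^ 2 + z.2 ^ 2
  have hδ : (0 : ℝ) ≤ 1 / (n : ℝ) ^ 2 := by positivity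
  let B : Set (Fin n → Euc d × ℝ) := {s | 1 ≤ L * (1 / (n : ℝ) ^ 2) * ∑ i, F (s i)}
  let W : (k' : ℕ) → HMoE d (K1 + 1) k' → Set (Fin n → Euc d × ℝ) := fun k' t =>
    {s | Real.exp (-1 / 2) ≤ ∏ i, √(pLL t (s i).1 (s i).2 / pLL Gs (s i).1 (s i).2)}
  have hsub : {s | ε < ∫ x, hellingerDist (pLL (Ghat n s).2 x) (pLL Gs x) ∂μ} ⊆
      B ∪ ⋃ k' ∈ Finset.Icc 1 k2, ⋃ t ∈ T k', W k' t := by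
    intro s hs
    by_cases hB : s ∈ B
    · exact Or.inl hB
    · right
      have hs' : ε < ∫ x, hellingerDist (pLL (Ghat n s).2 x) (pLL Gs x) ∂μ := hs
      obtain ⟨hmem, hmax⟩ := hMLE n s
      have hcmp := hmax ⟨K2 + 1, Gs⟩ ⟨by simp, hk2.le, hGs⟩
      generalize Ghat n s = G at hs' hmem hcmp
      obtain ⟨k', P⟩ := G
      obtain ⟨hk1', hk2', hPΘ⟩ := hmem
      simp only at hs' hk1' hk2' hPΘ hcmp
      obtain ⟨t, htT, ht⟩ := hT3 k' P ⟨hPΘ, hs'.le⟩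
      have htΘ : inParamSpace Θ t := (hT1 k' t htT).1
      have hcp := pLL_cond P (by omega) hk1' (hpos P hPΘ)
      have hct := pLL_cond t (by omega) hk1' (hpos t htΘ)
      refine Set.mem_iUnion₂.2 ⟨k', Finset.mem_Icc.2 ⟨hk1', hk2'⟩, Set.mem_iUnion₂.2 ⟨t, htT, ?_⟩⟩
      refine lr_step s (fun z => pLL Gs z.1 z.2) (fun z => pLL P z.1 z.2)
        (fun z => pLL t z.1 z.2) F (L * (1 / (n : ℝ) ^ 2)) (fun z => hp0.pos _ _)
        (fun z => hcp.pos _ _) (fun z => hct.pos _ _) (fun z => ?_) ?_ (not_le.1 hB)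
      · exact pLL_ratio P t hk1' v0 M _ hv0 hM hδ (hlow P hPΘ) (hlow t htΘ) (hnrm P hPΘ)
          (hnrm t htΘ) ht z.1 z.2
      · exact le_of_mul_le_mul_left hcmp (by positivity)
  have hBm : (Measure.pi fun _ : Fin n => Q) B ≤ ENNReal.ofReal (L * C / n) := by
    refine (markov_sum Q F (by fun_prop) (fun z => by positivity) C (L * (1 / (n : ℝ) ^ 2))
      (by positivity) hC n).trans (le_of_eq ?_)
    congr 1
    field_simp
  have hWm : ∀ k' ∈ Finset.Icc 1 k2, (Measure.pi fun _ : Fin n => Q) (⋃ t ∈ T k', W k' t) ≤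
      ENNReal.ofReal (Real.exp (1 / 2) * K k' / n) := by
    intro k' hk'
    have hk1' := (Finset.mem_Icc.1 hk').1
    have hDk : D k' ≤ Ds := Finset.single_le_sum (fun i _ => Nat.zero_le (D i)) hk'
    calc (Measure.pi fun _ : Fin n => Q) (⋃ t ∈ T k', W k' t)
        ≤ ∑ t ∈ T k', (Measure.pi fun _ : Fin n => Q) (W k' t) :=
          measure_biUnion_finset_le _ _
      _ ≤ ∑ t ∈ T k', ENNReal.ofReal (Real.exp (1 / 2) * Real.exp (-(n * ε ^ 2))) := by
          refine Finset.sum_le_sum fun t ht => ?_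
          have htb := hT1 k' t ht
          exact hp0.test_bound μ (pLL_cond t (by omega) hk1' (hpos t htb.1)) n ε hε0 htb.2
      _ = ENNReal.ofReal ((T k').card * (Real.exp (1 / 2) * Real.exp (-(n * ε ^ 2)))) := by
          rw [Finset.sum_const, nsmul_eq_mul, ENNReal.ofReal_mul (Nat.cast_nonneg _),
            ENNReal.ofReal_natCast]
      _ ≤ _ := by
          apply ENNReal.ofReal_le_ofReal
          rw [hnε]
          have h1 : ((T k').card : ℝ) ≤ K k' * (n : ℝ) ^ Ds :=
            (hT2 k').trans (mul_le_mul_of_nonneg_left (pow_le_pow_right₀ hn1 hDk) (hK k').le)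
          calc ((T k').card : ℝ) * (Real.exp (1 / 2) * ((n : ℝ) ^ (Ds + 1))⁻¹)
              ≤ (K k' * (n : ℝ) ^ Ds) * (Real.exp (1 / 2) * ((n : ℝ) ^ (Ds + 1))⁻¹) := by gcongr
            _ = _ := by rw [pow_succ]; field_simp
  calc _ ≤ (Measure.pi fun _ : Fin n => Q) (B ∪ ⋃ k' ∈ Finset.Icc 1 k2, ⋃ t ∈ T k', W k' t) :=
        measure_mono hsub
    _ ≤ (Measure.pi fun _ : Fin n => Q) B +
        ∑ k' ∈ Finset.Icc 1 k2, (Measure.pi fun _ : Fin n => Q) (⋃ t ∈ T k', W k' t) :=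
        (measure_union_le _ _).trans (by gcongr; exact measure_biUnion_finset_le _ _)
    _ ≤ ENNReal.ofReal (L * C / n) +
        ∑ k' ∈ Finset.Icc 1 k2, ENNReal.ofReal (Real.exp (1 / 2) * K k' / n) := by
        gcongr with k' hk'
        exact hWm k' hk'
    _ = ENNReal.ofReal (L * C / n + Real.exp (1 / 2) * Ks / n) := by
        rw [← ENNReal.ofReal_sum_of_nonneg fun k' _ => by have := hK k'; positivity,
          ← ENNReal.ofReal_add (by positivity)
            (Finset.sum_nonneg fun k' _ => by have := hK k'; positivity),
          ← Finset.sum_div, ← Finset.mul_sum]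
    _ ≤ _ := by
        apply ENNReal.ofReal_le_ofReal
        rw [one_mul, Real.exp_neg, Real.exp_log hn0, ← add_div, div_eq_mul_inv]
        exact mul_le_mul_of_nonneg_right (by linarith) (by positivity)
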